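/- arXiv:1811.09838 — 4 statements merged into one kernel-verified Lean document; each statement's English description precedes it below -/
import Mathlib

section
/- Let q be a real number with q > 1, let m and N be positive integers, let d₁, …, d_N ∈ ℝ^m be pairwise distinct vectors, and let P₁, …, P_N be nonzero real polynomials in m variables. Define h : (ℤ_{≥0})^m → ℝ by h(e₁, …, e_m) = Σ_{i=1}^N q^{d_{i1} e₁ + ⋯ + d_{im} e_m} · P_i(e₁, …, e_m). Then Σ_{(e₁,…,e_m) ∈ (ℤ_{≥0})^m} |h(e₁, …, e_m)| < ∞ if and only if d_{it} < 0 for every 1 ≤ i ≤ N and every 1 ≤ t ≤ m. -/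
namespace MvPolynomial

variable {σ : Type*}

/-- One more than the total degree of a nonzero polynomial, and `0` for the zero polynomial. -/
noncomputable def degreeSucc (P : MvPolynomial σ ℝ) : ℕ :=
  P.support.sup fun s => s.degree + 1

theorem degreeSucc_le_iff {P : MvPolynomial σ ℝ} {n : ℕ} :
    degreeSucc P ≤ n ↔ ∀ s, coeff s P ≠ 0 → s.degree + 1 ≤ n := by
  simp [degreeSucc, Finset.sup_le_iff]

theorem degreeSucc_pos {P : MvPolynomial σ ℝ} (hP : P ≠ 0) : 0 < degreeSucc P := by
  obtain ⟨s, hs⟩ := ne_zero_iff.mp hP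
  have := degreeSucc_le_iff.mp le_rfl s hs
  omega

theorem degreeSucc_add_le {P Q : MvPolynomial σ ℝ} {n : ℕ}
    (hP : degreeSucc P ≤ n) (hQ : degreeSucc Q ≤ n) : degreeSucc (P + Q) ≤ n := by
  rw [degreeSucc_le_iff] at *
  intro s hs
  by_cases h : coeff s P = 0
  · exact hQ s fun h' => hs (by rw [coeff_add, h, h', add_zero])
  · exact hP s h

theorem degreeSucc_C_mul_le (c : ℝ) (P : MvPolynomial σ ℝ) :
    degreeSucc (C c * P) ≤ degreeSucc P := by
  rw [degreeSucc_le_iff]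
  intro s hs
  rw [coeff_C_mul] at hs
  exact degreeSucc_le_iff.mp le_rfl s (right_ne_zero_of_mul hs)

theorem degreeSucc_mul_X_le (P : MvPolynomial σ ℝ) (u : σ) :
    degreeSucc (P * X u) ≤ degreeSucc P + 1 := by
  rw [degreeSucc_le_iff]
  intro s hs
  rw [← mem_support_iff, support_mul_X, Finset.mem_map] at hs
  obtain ⟨r, hr, rfl⟩ := hs
  have := degreeSucc_le_iff.mp le_rfl r (mem_support_iff.mp hr)
  simpa using this

theorem degreeSucc_sum_le {ι : Type*} (S : Finset ι) (P : ι → MvPolynomial σ ℝ) (n : ℕ)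
    (h : ∀ i ∈ S, degreeSucc (P i) ≤ n) : degreeSucc (∑ i ∈ S, P i) ≤ n :=
  Finset.sum_induction P (fun Q => degreeSucc Q ≤ n) (fun _ _ => degreeSucc_add_le)
    (by simp [degreeSucc]) h

theorem degreeSucc_monomial_le (s : σ →₀ ℕ) (c : ℝ) :
    degreeSucc (monomial s c) ≤ s.degree + 1 := by
  classical
  rw [degreeSucc_le_iff]
  intro r hr
  rw [coeff_monomial] at hr
  have : s = r := by by_contra h; simp [h] at hr
  rw [this]

theorem eq_zero_of_eval_natCast [Finite σ] {P : MvPolynomial σ ℝ}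
    (h : ∀ e : σ → ℕ, eval (fun u => (e u : ℝ)) P = 0) : P = 0 := by
  refine funext_set (fun _ => Set.range ((↑) : ℕ → ℝ))
    (fun _ => Set.infinite_range_of_injective Nat.cast_injective) fun x hx => ?_
  choose e he using fun u => hx u (Set.mem_univ u)
  have : x = fun u => (e u : ℝ) := by ext u; exact (he u).symm
  rw [this, h, map_zero]

variable [DecidableEq σ]

/-- Translation of the variable `X t` by `1`. -/
noncomputable def shift (t : σ) : MvPolynomial σ ℝ →ₐ[ℝ] MvPolynomial σ ℝ :=
  aeval fun u => X u + C (if u = t then 1 else 0)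

theorem eval_shift (t : σ) (P : MvPolynomial σ ℝ) (e : σ → ℕ) :
    eval (fun u => (e u : ℝ)) (shift t P) =
      eval (fun u => ((e + Pi.single t 1 : σ → ℕ) u : ℝ)) P := by
  induction P using MvPolynomial.induction_on with
  | C a => simp [shift]
  | add p q hp hq => rw [map_add, map_add, map_add, hp, hq]
  | mul_X p u hp =>
    rw [map_mul, map_mul, map_mul, hp]
    simp [shift, Pi.single_apply]

theorem degreeSucc_shift_monomial_sub_le (t : σ) (s : σ →₀ ℕ) :
    degreeSucc (shift t (monomial s 1) - monomial s 1) ≤ s.degree := by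
  induction hn : s.degree generalizing s with
  | zero =>
    obtain rfl : s = 0 := (Finsupp.degree_eq_zero_iff s).mp hn
    simp [shift, degreeSucc]
  | succ n ih =>
    obtain ⟨u, hu⟩ : ∃ u, s u ≠ 0 := by
      by_contra! hc
      obtain rfl : s = 0 := Finsupp.ext hc
      simp at hn
    obtain ⟨r, rfl⟩ : ∃ r, s = r + Finsupp.single u 1 :=
      ⟨s - Finsupp.single u 1, (tsub_add_cancel_of_le (by
        simpa [Finsupp.single_le_iff] using Nat.one_le_iff_ne_zero.mpr hu)).symm⟩
    have hr : r.degree = n := by simpa using hn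
    set c : ℝ := if u = t then 1 else 0 with hc
    have hX : shift t (X u) = X u + C c := by simp [shift, hc]
    have h : shift t (monomial (r + Finsupp.single u 1) 1) - monomial (r + Finsupp.single u 1) 1 =
        (shift t (monomial r 1) - monomial r 1) * X u +
          (C c * (shift t (monomial r 1) - monomial r 1) + C c * monomial r 1) := by
      rw [monomial_add_single, pow_one, map_mul, hX]
      ring
    rw [h]
    have hdiff := ih r hr
    refine degreeSucc_add_le ((degreeSucc_mul_X_le _ _).trans (by omega)) (degreeSucc_add_le
      ((degreeSucc_C_mul_le _ _).trans (by omega)) ((degreeSucc_C_mul_le _ _).trans ?_))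
    simpa [hr] using degreeSucc_monomial_le r 1

theorem degreeSucc_shift_sub_le (t : σ) (P : MvPolynomial σ ℝ) :
    degreeSucc (shift t P - P) ≤ degreeSucc P - 1 := by
  have h : shift t P - P =
      ∑ s ∈ P.support, C (coeff s P) * (shift t (monomial s 1) - monomial s 1) := by
    conv_lhs => rw [← support_sum_monomial_coeff P]
    rw [map_sum, ← Finset.sum_sub_distrib]
    refine Finset.sum_congr rfl fun s _ => ?_
    rw [← mul_one (coeff s P), ← C_mul_monomial, map_mul, mul_sub, mul_one]
    congr 2
    simp [shift]
  rw [h]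
  refine degreeSucc_sum_le _ _ _ fun s hs => (degreeSucc_C_mul_le _ _).trans ?_
  have h1 := degreeSucc_shift_monomial_sub_le t s
  have h2 := degreeSucc_le_iff.mp le_rfl s (mem_support_iff.mp hs)
  omega

theorem degreeSucc_twisted_shift_le (t : σ) (a c : ℝ) (P : MvPolynomial σ ℝ) :
    degreeSucc (C a * shift t P - C c * P) ≤ degreeSucc P := by
  have h : C a * shift t P - C c * P = C a * (shift t P - P) + C (a - c) * P := by
    rw [C_sub]; ring
  rw [h]
  refine degreeSucc_add_le ((degreeSucc_C_mul_le _ _).trans ?_) (degreeSucc_C_mul_le _ _)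
  exact (degreeSucc_shift_sub_le t P).trans (Nat.sub_le _ _)

theorem degreeSucc_twisted_shift_lt (t : σ) (a : ℝ) {P : MvPolynomial σ ℝ} (hP : P ≠ 0) :
    degreeSucc (C a * shift t P - C a * P) < degreeSucc P := by
  rw [← mul_sub]
  have h1 := degreeSucc_C_mul_le a (shift t P - P)
  have h2 := degreeSucc_shift_sub_le t P
  have h3 := degreeSucc_pos hP
  omega

theorem twisted_shift_ne_zero (t : σ) {a c : ℝ} (hac : a ≠ c) {P : MvPolynomial σ ℝ}
    (hP : P ≠ 0) : C a * shift t P - C c * P ≠ 0 := by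
  intro h
  have hca : c - a ≠ 0 := sub_ne_zero.mpr hac.symm
  have h' : P = C (a / (c - a)) * (shift t P - P) := by
    have h1 : C (c - a) * P = C a * (shift t P - P) := by
      rw [C_sub]; linear_combination -h
    have h2 : (C (c - a)⁻¹ * C (c - a) : MvPolynomial σ ℝ) = 1 := by
      rw [← C_mul, inv_mul_cancel₀ hca, C_1]
    rw [div_eq_inv_mul, C_mul, mul_assoc, ← h1, ← mul_assoc, h2, one_mul]
  have h1 := degreeSucc_C_mul_le (a / (c - a)) (shift t P - P)
  have h2 := degreeSucc_shift_sub_le t P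
  have h3 := degreeSucc_pos hP
  rw [← h'] at h1
  omega

theorem eval_natCast_eq_of_shift_eq [Finite σ] {P : MvPolynomial σ ℝ}
    (h : ∀ t, shift t P = P) (e : σ → ℕ) : eval (fun u => (e u : ℝ)) P = eval 0 P := by
  cases nonempty_fintype σ
  induction hn : ∑ u, e u generalizing e with
  | zero =>
    have : e = 0 := by ext u; simpa using (Finset.sum_eq_zero_iff.mp hn) u
    subst this
    congr 2
    ext u; simp
  | succ n ih =>
    obtain ⟨t, ht⟩ : ∃ t, e t ≠ 0 := by
      by_contra! hc
      simp [hc] at hn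
    obtain ⟨f, rfl⟩ : ∃ f : σ → ℕ, e = f + Pi.single t 1 := by
      refine ⟨e - Pi.single t 1, (tsub_add_cancel_of_le ?_).symm⟩
      intro u
      rcases eq_or_ne u t with rfl | hu
      · simpa using Nat.one_le_iff_ne_zero.mpr ht
      · simp [hu]
    rw [← eval_shift, h, ih]
    simpa [Finset.sum_add_distrib] using hn

end MvPolynomial

open MvPolynomial

theorem neg_of_summable_exponential_polynomial {σ ι : Type*} [Fintype σ] [DecidableEq σ]
    [Fintype ι] {q : ℝ} (hq : 1 < q) {d : ι → σ → ℝ} (hd : Function.Injective d)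
    {P : ι → MvPolynomial σ ℝ} {i : ι} (hi : P i ≠ 0)
    (hsum : Summable fun e : σ → ℕ =>
      ∑ j, q ^ (∑ t, d j t * e t) * eval (fun t => (e t : ℝ)) (P j)) (t : σ) :
    d i t < 0 := by
  have hq0 : 0 < q := by linarith
  induction hn : ∑ j, degreeSucc (P j) using Nat.strong_induction_on generalizing P with
  | _ n ih =>
  have step (s : σ) (c : ℝ) (hne : C (q ^ d i s) * shift s (P i) - C c * P i ≠ 0)
      (hlt : ∃ j, degreeSucc (C (q ^ d j s) * shift s (P j) - C c * P j) < degreeSucc (P j)) :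
      d i t < 0 := by
    refine ih _ ?_ (P := fun j => C (q ^ d j s) * shift s (P j) - C c * P j) hne ?_ rfl
    · rw [← hn]
      obtain ⟨j, hj⟩ := hlt
      exact Finset.sum_lt_sum (fun k _ => degreeSucc_twisted_shift_le _ _ _ _)
        ⟨j, Finset.mem_univ j, hj⟩
    · have hshift := hsum.comp_injective (add_left_injective (Pi.single s 1 : σ → ℕ))
      refine (hshift.sub (hsum.mul_left c)).congr fun e => ?_
      rw [Finset.mul_sum, Function.comp_apply, ← Finset.sum_sub_distrib]
      refine Finset.sum_congr rfl fun j _ => ?_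
      have hexp : ∑ u, d j u * ((e + Pi.single s 1 : σ → ℕ) u : ℝ) =
          ∑ u, d j u * e u + d j s := by
        simp [mul_add, Finset.sum_add_distrib, Pi.single_apply]
      rw [hexp, Real.rpow_add hq0, map_sub, map_mul, map_mul, eval_C, eval_C, eval_shift]
      ring
  by_cases hother : ∃ j, j ≠ i ∧ P j ≠ 0
  · obtain ⟨j, hji, hj⟩ := hother
    obtain ⟨s, hs⟩ := Function.ne_iff.mp (hd.ne hji)
    refine step s (q ^ d j s) (twisted_shift_ne_zero s ?_ hi)
      ⟨j, degreeSucc_twisted_shift_lt _ _ hj⟩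
    exact fun h => hs ((Real.rpow_right_inj hq0 hq.ne').mp h).symm
  · push Not at hother
    by_cases hconst : ∀ s, shift s (P i) = P i
    · have heval := eval_natCast_eq_of_shift_eq hconst
      have hc : eval 0 (P i) ≠ 0 := fun h =>
        hi (eq_zero_of_eval_natCast fun e => (heval e).trans h)
      have hgeom := hsum.comp_injective (Pi.single_injective (M := fun _ : σ => ℕ) t)
      have hgeom' : Summable fun k : ℕ => (q ^ d i t) ^ k := by
        refine (summable_mul_right_iff hc).mp (hgeom.congr fun k => ?_)
        rw [Function.comp_apply, Finset.sum_eq_single i (fun j _ hj => by simp [hother j hj])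
          (by simp), heval]
        congr 1
        rw [← Real.rpow_natCast, ← Real.rpow_mul hq0.le]
        simp [Pi.single_apply]
      have h1 := summable_geometric_iff_norm_lt_one.mp hgeom'
      rw [Real.norm_of_nonneg (by positivity)] at h1
      by_contra! h
      exact absurd (Real.one_le_rpow hq.le h) (not_le.mpr h1)
    · push Not at hconst
      obtain ⟨s, hs⟩ := hconst
      refine step s (q ^ d i s) ?_ ⟨i, degreeSucc_twisted_shift_lt _ _ hi⟩
      rw [← mul_sub]
      refine mul_ne_zero ?_ (sub_ne_zero.mpr hs)
      rw [Ne, C_eq_zero]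
      positivity

theorem summable_prod_apply {m : ℕ} {f : Fin m → ℕ → ℝ} (hf : ∀ t, Summable (f t)) :
    Summable fun e : Fin m → ℕ => ∏ t, f t (e t) := by
  induction m with
  | zero => exact Summable.of_finite
  | succ m ih =>
    rw [← (Fin.consEquiv fun _ : Fin (m + 1) => ℕ).summable_iff]
    refine (summable_mul_of_summable_norm (hf 0).norm
      (ih fun t => hf t.succ).norm).congr fun x => ?_
    simp [Fin.prod_univ_succ, Fin.consEquiv]

theorem summable_exponential_mul_polynomial {m : ℕ} {q : ℝ} (hq : 1 < q) {d : Fin m → ℝ}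
    (hd : ∀ t, d t < 0) (P : MvPolynomial (Fin m) ℝ) :
    Summable fun e : Fin m → ℕ =>
      q ^ (∑ t, d t * e t) * eval (fun t => (e t : ℝ)) P := by
  have hq0 : 0 < q := by linarith
  have key (s : Fin m →₀ ℕ) : Summable fun e : Fin m → ℕ =>
      coeff s P * ∏ t, ((e t : ℝ) ^ s t * (q ^ d t) ^ e t) := by
    refine (summable_prod_apply (f := fun t k => (k : ℝ) ^ s t * (q ^ d t) ^ k)
      fun t => summable_pow_mul_geometric_of_norm_lt_one (s t) ?_).mul_left (coeff s P)
    rw [Real.norm_of_nonneg (by positivity)]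
    exact Real.rpow_lt_one_of_one_lt_of_neg hq (hd t)
  refine (summable_sum fun s (_ : s ∈ P.support) => key s).congr fun e => ?_
  rw [eval_eq', Finset.mul_sum]
  refine Finset.sum_congr rfl fun s _ => ?_
  have hprod : ∏ t, (q ^ d t) ^ e t = q ^ (∑ t, d t * e t) := by
    rw [Real.rpow_sum_of_pos hq0]
    exact Finset.prod_congr rfl fun t _ => by rw [Real.rpow_mul hq0.le, Real.rpow_natCast]
  rw [Finset.prod_mul_distrib, hprod]
  ring

/-- Let `q > 1`, let `d i ∈ ℝ^m` (for `i < N`) be pairwise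
distinct vectors and let `P i` be nonzero real polynomials in `m` variables.
Set `h(e) = Σ_i q^(Σ_t d i t * e t) * P i (e)` for `e ∈ ℕ^m`.  Then
`Σ_{e ∈ ℕ^m} |h(e)| < ∞` if and only if `d i t < 0` for all `i` and `t`. -/
theorem summable_exponential_polynomial_sum_iff
    (q : ℝ) (hq : 1 < q) (m N : ℕ) (hm : 0 < m) (hN : 0 < N)
    (d : Fin N → Fin m → ℝ) (hd : Function.Injective d)
    (P : Fin N → MvPolynomial (Fin m) ℝ) (hP : ∀ i, P i ≠ 0) :
    Summable (fun e : Fin m → ℕ =>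
        |∑ i : Fin N, q ^ (∑ t, d i t * e t) *
          MvPolynomial.eval (fun t => (e t : ℝ)) (P i)|)
      ↔ ∀ i t, d i t < 0 := by
  rw [summable_abs_iff]
  refine ⟨fun h i t => neg_of_summable_exponential_polynomial hq hd (hP i) h t, fun h => ?_⟩
  exact summable_sum fun i _ => summable_exponential_mul_polynomial hq (h i) (P i)
end

section
/- There exist a function g : ℝ → ℂ and a constant C > 0 such that: (i) g has compact support; (ii) g is Lebesgue integrable, i.e., g ∈ L¹(ℝ); (iii) the Fourier transform 𝓕g(y) = ∫_ℝ g(x) e^{−2πi x y} dx satisfies |𝓕g(y)| ≤ C · (1 + |y|)^{−1/8} for every y ∈ ℝ; and (iv) for every ε > 0, g is not in L^{1+ε}(ℝ), i.e., ∫_ℝ |g(x)|^{1+ε} dx = ∞. -/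
open MeasureTheory FourierTransform Real

lemma fourier_add_apply {f g : ℝ → ℂ} (hf : Integrable f) (hg : Integrable g) (y : ℝ) :
    𝓕 (f + g) y = 𝓕 f y + 𝓕 g y := by
  simp only [Real.fourier_real_eq, Pi.add_apply, smul_add]
  refine integral_add ?_ ?_
  · simpa [mul_comm] using (Real.fourierIntegral_convergent_iff y).2 hf
  · simpa [mul_comm] using (Real.fourierIntegral_convergent_iff y).2 hg

lemma fourier_sub_apply {f g : ℝ → ℂ} (hf : Integrable f) (hg : Integrable g) (y : ℝ) :
    𝓕 (f - g) y = 𝓕 f y - 𝓕 g y := by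
  have h := fourier_add_apply (hf.sub hg) hg y
  rw [sub_add_cancel] at h
  exact eq_sub_of_add_eq h.symm

lemma norm_fourier_comp_sub_right (f : ℝ → ℂ) (d y : ℝ) :
    ‖𝓕 (fun x => f (x - d)) y‖ = ‖𝓕 f y‖ := by
  have h := congrFun (VectorFourier.fourierIntegral_comp_add_right 𝐞 volume (innerₗ ℝ) f (-d)) y
  have h2 : 𝓕 (fun x => f (x - d)) y = 𝐞 (innerₗ ℝ (-d) y) • 𝓕 f y := h
  rw [h2, Circle.norm_smul]

lemma fourier_const_mul (a : ℂ) (f : ℝ → ℂ) (y : ℝ) :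
    𝓕 (fun x => a * f x) y = a * 𝓕 f y :=
  congrFun (VectorFourier.fourierIntegral_const_smul 𝐞 volume (innerₗ ℝ) f a) y

lemma norm_fourier_le_integral_norm (f : ℝ → ℂ) (y : ℝ) : ‖𝓕 f y‖ ≤ ∫ x, ‖f x‖ :=
  VectorFourier.norm_fourierIntegral_le_integral_norm 𝐞 volume (innerₗ ℝ) f y

lemma norm_fourier_indicator_Ico_le (c : ℝ) {l : ℝ} (hl : 0 ≤ l) (y : ℝ) :
    ‖𝓕 ((Set.Ico c (c + l)).indicator (1 : ℝ → ℂ)) y‖ ≤ l := by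
  refine (norm_fourier_le_integral_norm _ y).trans_eq ?_
  simp_rw [norm_indicator_eq_indicator_norm]
  rw [integral_indicator measurableSet_Ico]
  simp [hl]

lemma norm_fourier_indicator_Ico_mul_abs_le (c : ℝ) {l : ℝ} (hl : 0 ≤ l) (y : ℝ) :
    ‖𝓕 ((Set.Ico c (c + l)).indicator (1 : ℝ → ℂ)) y‖ * |y| ≤ 1 := by
  rcases eq_or_ne y 0 with rfl | hy
  · simp
  set a : ℂ := ((-2 * π * y : ℝ) : ℂ) * Complex.I with ha
  have ha0 : a ≠ 0 := by
    simp [ha, hy, pi_ne_zero]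
  have hexp (t : ℝ) : ‖Complex.exp (a * t)‖ = 1 := by
    have : a * t = ((-2 * π * y * t : ℝ) : ℂ) * Complex.I := by
      rw [ha]; push_cast; ring
    rw [this, Complex.norm_exp_ofReal_mul_I]
  have hna : ‖a‖ = 2 * π * |y| := by
    simp [ha, abs_of_pos pi_pos]
  have key : 𝓕 ((Set.Ico c (c + l)).indicator (1 : ℝ → ℂ)) y
      = (Complex.exp (a * (c + l : ℝ)) - Complex.exp (a * c)) / a := by
    rw [← integral_exp_mul_complex ha0, intervalIntegral.integral_of_le (by linarith),
      ← integral_Ico_eq_integral_Ioc, ← integral_indicator measurableSet_Ico,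
      Real.fourier_real_eq_integral_exp_smul]
    congr 1 with x
    by_cases hx : x ∈ Set.Ico c (c + l)
    · simp only [Set.indicator_of_mem hx, ha, Pi.one_apply, smul_eq_mul, mul_one]
      congr 1
      push_cast; ring
    · simp [Set.indicator_of_notMem hx]
  have h2 := norm_sub_le (Complex.exp (a * (c + l : ℝ))) (Complex.exp (a * c))
  rw [hexp, hexp] at h2
  have hy' : 0 < |y| := abs_pos.2 hy
  rw [key, norm_div, hna, div_mul_eq_mul_div, div_le_one (by positivity)]
  nlinarith [pi_gt_three]

/-- Rudin-Shapiro pairs of step functions: two functions of modulus one on an interval consisting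
of `2 ^ k` steps of length `l`, whose Fourier transforms have the least possible joint size. -/
lemma exists_rudinShapiro_pair (c : ℝ) {l : ℝ} (hl : 0 ≤ l) (k : ℕ) :
    ∃ p q : ℝ → ℂ, Integrable p ∧ Integrable q ∧
      (∀ x, ‖p x‖ = (Set.Ico c (c + 2 ^ k * l)).indicator 1 x) ∧
      (∀ x, ‖q x‖ = (Set.Ico c (c + 2 ^ k * l)).indicator 1 x) ∧
      ∀ y, ‖𝓕 p y‖ ^ 2 + ‖𝓕 q y‖ ^ 2
        = 2 ^ (k + 1) * ‖𝓕 ((Set.Ico c (c + l)).indicator (1 : ℝ → ℂ)) y‖ ^ 2 := by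
  induction k with
  | zero =>
    have hi : Integrable ((Set.Ico c (c + l)).indicator (1 : ℝ → ℂ)) :=
      (integrable_indicator_iff measurableSet_Ico).2 (by simp [Pi.one_def])
    have hn (x : ℝ) : ‖(Set.Ico c (c + l)).indicator (1 : ℝ → ℂ) x‖
        = (Set.Ico c (c + 2 ^ 0 * l)).indicator 1 x := by
      rw [norm_indicator_eq_indicator_norm]
      simp [Set.indicator]
    exact ⟨_, _, hi, hi, hn, hn, fun y => by ring⟩
  | succ k ih =>
    obtain ⟨p, q, hp, hq, hpn, hqn, hpq⟩ := ih
    set d : ℝ := 2 ^ k * l with hd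
    have hd0 : 0 ≤ d := by positivity
    have hr : Integrable fun x => q (x - d) := hq.comp_sub_right d
    have hd2 : (2 : ℝ) ^ (k + 1) * l = d + d := by rw [hd]; ring
    have hrn (x : ℝ) : ‖q (x - d)‖ = (Set.Ico (c + d) (c + (d + d))).indicator 1 x := by
      rw [hqn]
      simp only [Set.indicator, Set.mem_Ico, Pi.one_apply]
      congr 1
      apply propext
      constructor <;> rintro ⟨h1, h2⟩ <;> constructor <;> linarith
    have hcases (x : ℝ) : (p x = 0 ∨ q (x - d) = 0) ∧
        ‖p x‖ + ‖q (x - d)‖ = (Set.Ico c (c + (d + d))).indicator 1 x := by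
      rw [← norm_eq_zero, ← norm_eq_zero (a := q _), hpn, hrn]
      simp only [Set.indicator, Set.mem_Ico, Pi.one_apply]
      split_ifs <;> simp <;> grind
    refine ⟨p + fun x => q (x - d), p - fun x => q (x - d), hp.add hr, hp.sub hr,
      fun x => ?_, fun x => ?_, fun y => ?_⟩
    · rw [hd2, ← (hcases x).2]
      rcases (hcases x).1 with h | h <;> simp [h]
    · rw [hd2, ← (hcases x).2]
      rcases (hcases x).1 with h | h <;> simp [h]
    · rw [fourier_add_apply hp hr, fourier_sub_apply hp hr]
      have := parallelogram_law_with_norm ℝ (𝓕 p y) (𝓕 (fun x => q (x - d)) y)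
      rw [norm_fourier_comp_sub_right] at this
      rw [pow_succ 2 (k + 1)]
      linarith [hpq y]

/-- A function of modulus `2 ^ n` on `[2⁻ⁿ, 2 · 2⁻ⁿ)`, zero elsewhere, whose Fourier transform
decays at a rate independent of `n`. -/
lemma exists_fourier_decay_of_dyadic_norm (n : ℕ) :
    ∃ f : ℝ → ℂ, Integrable f ∧
      (∀ x, ‖f x‖ =
        (Set.Ico ((2 : ℝ) ^ n)⁻¹ (2 * ((2 : ℝ) ^ n)⁻¹)).indicator (fun _ => 2 ^ n) x) ∧
      ∀ y, ‖𝓕 f y‖ ≤ 2 * (1 + |y|) ^ (-(1 / 8 : ℝ)) := by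
  set M : ℝ := 2 ^ n with hM
  have hM1 : 1 ≤ M := one_le_pow₀ (by norm_num)
  have hM0 : 0 < M := by linarith
  obtain ⟨p, q, hp, -, hpn, -, hpq⟩ :=
    exists_rudinShapiro_pair M⁻¹ (l := (M ^ 2)⁻¹) (by positivity) n
  refine ⟨fun x => (M : ℂ) * p x, hp.const_mul _, fun x => ?_, fun y => ?_⟩
  · rw [norm_mul, hpn, ← hM, show M⁻¹ + M * (M ^ 2)⁻¹ = 2 * M⁻¹ by field_simp; norm_num]
    simp [Set.indicator, abs_of_pos hM0]
  · rw [fourier_const_mul, norm_mul, Complex.norm_real, norm_of_nonneg hM0.le]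
    have h1 := norm_fourier_indicator_Ico_le M⁻¹ (l := (M ^ 2)⁻¹) (by positivity) y
    have h2 := norm_fourier_indicator_Ico_mul_abs_le M⁻¹ (l := (M ^ 2)⁻¹) (by positivity) y
    have h3 := hpq y
    set b := ‖𝓕 ((Set.Ico M⁻¹ (M⁻¹ + (M ^ 2)⁻¹)).indicator (1 : ℝ → ℂ)) y‖
    have hb0 : 0 ≤ b := norm_nonneg _
    set t := M * ‖𝓕 p y‖ with ht
    have ht0 : 0 ≤ t := by positivity
    have ht2 : t ^ 2 ≤ 2 * M ^ 3 * b ^ 2 := by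
      rw [ht, mul_pow]
      have : ‖𝓕 p y‖ ^ 2 ≤ 2 * M * b ^ 2 := by
        rw [pow_succ 2 n, ← hM] at h3
        nlinarith [sq_nonneg ‖𝓕 q y‖]
      nlinarith [sq_nonneg M]
    have hMb : M ^ 2 * b ≤ 1 := by
      calc M ^ 2 * b ≤ M ^ 2 * (M ^ 2)⁻¹ := by gcongr
        _ = 1 := by field_simp
    have hb1 : b ≤ 1 := h1.trans (inv_le_one_of_one_le₀ (one_le_pow₀ hM1))
    have hA : t ^ 8 ≤ 16 := by
      calc t ^ 8 = (t ^ 2) ^ 4 := by ring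
        _ ≤ (2 * M ^ 3 * b ^ 2) ^ 4 := by gcongr
        _ = 16 * (M ^ 2 * b) ^ 6 * b ^ 2 := by ring
        _ ≤ 16 * 1 ^ 6 * 1 ^ 2 := by
          gcongr
        _ = 16 := by norm_num
    have hB : t ^ 8 * |y| ≤ 16 := by
      calc t ^ 8 * |y| = (t ^ 2) ^ 4 * |y| := by ring
        _ ≤ (2 * M ^ 3 * b ^ 2) ^ 4 * |y| := by gcongr
        _ = 16 * (M ^ 2 * b) ^ 6 * b * (b * |y|) := by ring
        _ ≤ 16 * 1 ^ 6 * 1 * 1 := by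
          gcongr
        _ = 16 := by norm_num
    have hpos : 0 < 1 + |y| := by positivity
    refine le_of_pow_le_pow_left₀ (n := 8) (by norm_num) (by positivity) ?_
    rw [mul_pow 2, ← rpow_natCast ((1 + |y|) ^ _), ← rpow_mul hpos.le,
      show -(1 / 8 : ℝ) * (8 : ℕ) = -1 by norm_num, rpow_neg_one, ← div_eq_mul_inv,
      le_div_iff₀ hpos]
    linarith

lemma integrable_tsum_of_summable_integral_norm {F : ℕ → ℝ → ℂ} (hF : ∀ n, Integrable (F n))
    (hsum : Summable fun n => ∫ x, ‖F n x‖) (hpt : ∀ x, Summable fun n => F n x) :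
    Integrable fun x => ∑' n, F n x := by
  refine ⟨aestronglyMeasurable_of_tendsto_ae Filter.atTop
    (f := fun N x => ∑ n ∈ Finset.range N, F n x)
    (fun N => (integrable_finsetSum _ fun n _ => hF n).1)
    (.of_forall fun x => (hpt x).hasSum.tendsto_sum_nat), ?_⟩
  calc ∫⁻ x, ‖∑' n, F n x‖ₑ ≤ ∫⁻ x, ∑' n, ‖F n x‖ₑ :=
        lintegral_mono fun x => enorm_tsum_le_tsum_enorm
    _ = ∑' n, ENNReal.ofReal (∫ x, ‖F n x‖) := by
        rw [lintegral_tsum fun n => (hF n).1.enorm]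
        simp_rw [ofReal_integral_norm_eq_lintegral_enorm (hF _)]
    _ < ⊤ := hsum.tsum_ofReal_lt_top

lemma eq_of_mem_dyadic_Ico {m n : ℕ} {x : ℝ}
    (hm : x ∈ Set.Ico ((2 : ℝ) ^ m)⁻¹ (2 * ((2 : ℝ) ^ m)⁻¹))
    (hn : x ∈ Set.Ico ((2 : ℝ) ^ n)⁻¹ (2 * ((2 : ℝ) ^ n)⁻¹)) : m = n := by
  have key {m n : ℕ} (hm : ((2 : ℝ) ^ m)⁻¹ ≤ x) (hn : x < 2 * ((2 : ℝ) ^ n)⁻¹) : n ≤ m := by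
    by_contra! h
    have h1 : (2 : ℝ) ^ (m + 1) ≤ 2 ^ n := pow_le_pow_right₀ (by norm_num) h
    have h2 := inv_anti₀ (by positivity) h1
    rw [pow_succ, mul_inv] at h2
    linarith
  exact le_antisymm (key hn.1 hm.2) (key hm.1 hn.2)

lemma setLIntegral_dyadic_Ico (n : ℕ) (hn : 1 ≤ n) (ε : ℝ) :
    ∫⁻ _ in Set.Ico ((2 : ℝ) ^ n)⁻¹ (2 * ((2 : ℝ) ^ n)⁻¹),
      ENNReal.ofReal (1 / (n : ℝ) ^ 2 * 2 ^ n) ^ (1 + ε)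
      = ENNReal.ofReal (rexp (log 2 * ε * n) / (n : ℝ) ^ (2 * (1 + ε))) := by
  have hn0 : (0 : ℝ) < n := by exact_mod_cast hn
  rw [setLIntegral_const, Real.volume_Ico, ENNReal.ofReal_rpow_of_pos (by positivity),
    ← ENNReal.ofReal_mul (by positivity)]
  congr 1
  have h1 : rexp (log 2 * ε * n) = ((2 : ℝ) ^ n) ^ ε := by
    rw [← rpow_natCast, ← rpow_mul (by norm_num), rpow_def_of_pos (by norm_num)]
    ring_nf
  have h2 : (n : ℝ) ^ (2 * (1 + ε)) = ((n : ℝ) ^ 2) ^ (1 + ε) := by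
    rw [rpow_mul hn0.le]; norm_num
  rw [h1, h2, mul_rpow (by positivity) (by positivity), div_rpow (by positivity) (by positivity),
    one_rpow, rpow_add (by positivity : (0 : ℝ) < 2 ^ n), rpow_one]
  field_simp
  ring

/-- There exist a compactly supported integrable function
`g : ℝ → ℂ` and a constant `C > 0` such that the Fourier transform of `g`
satisfies `|𝓕g(y)| ≤ C (1 + |y|)^(-1/8)` for all `y`, while for every `ε > 0`
the function `g` is not in `L^{1+ε}(ℝ)`, i.e. `∫ |g|^{1+ε} = ∞`. -/
theorem exists_integrable_fourier_decay_not_memLp :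
    ∃ (g : ℝ → ℂ) (C : ℝ), 0 < C ∧
      HasCompactSupport g ∧
      Integrable g ∧
      (∀ y : ℝ, ‖𝓕 g y‖ ≤ C * (1 + |y|) ^ (-(1 / 8 : ℝ))) ∧
      (∀ ε : ℝ, 0 < ε → ∫⁻ x : ℝ, (‖g x‖₊ : ENNReal) ^ (1 + ε) = ⊤) := by
  choose f hfi hfn hff using exists_fourier_decay_of_dyadic_norm
  set I : ℕ → Set ℝ := fun n => Set.Ico ((2 : ℝ) ^ n)⁻¹ (2 * ((2 : ℝ) ^ n)⁻¹)
  set a : ℕ → ℝ := fun n => 1 / (n : ℝ) ^ 2 with ha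
  have ha0 (n : ℕ) : 0 ≤ a n := by positivity
  have has : Summable a := summable_one_div_nat_pow.2 one_lt_two
  set F : ℕ → ℝ → ℂ := fun n x => (a n : ℂ) * f n x with hF
  have hf0 {n : ℕ} {x : ℝ} (hx : x ∉ I n) : f n x = 0 := by
    rw [← norm_eq_zero, hfn, Set.indicator_of_notMem hx]
  have hFi (n : ℕ) : Integrable (F n) := (hfi n).const_mul _
  have hFnorm (n : ℕ) : ∫ x, ‖F n x‖ = a n := by
    simp only [hF, norm_mul, Complex.norm_real, norm_of_nonneg (ha0 n), hfn]
    rw [integral_const_mul, integral_indicator measurableSet_Ico, setIntegral_const,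
      measureReal_def, Real.volume_Ico, ENNReal.toReal_ofReal (by ring_nf; positivity)]
    simp only [smul_eq_mul]
    field_simp
    ring
  have hsum : Summable fun n => ∫ x, ‖F n x‖ := by simpa only [hFnorm] using has
  have hFx {n : ℕ} {x : ℝ} (hx : x ∈ I n) (m : ℕ) (hm : m ≠ n) : F m x = 0 := by
    simp [hF, hf0 fun h => hm (eq_of_mem_dyadic_Ico h hx)]
  have hpt (x : ℝ) : Summable fun n => F n x := by
    by_cases h : ∃ n, x ∈ I n
    · obtain ⟨n, hn⟩ := h
      exact summable_of_ne_finset_zero (s := {n}) fun m hm => hFx hn m (by simpa using hm)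
    · push Not at h
      simp [hF, hf0 (h _), summable_zero]
  have hA : 0 < ∑' n, a n := has.tsum_pos ha0 1 (by simp [ha])
  refine ⟨fun x => ∑' n, F n x, (∑' n, a n) * 2, by positivity, ?_,
    integrable_tsum_of_summable_integral_norm hFi hsum hpt, fun y => ?_, fun ε hε => ?_⟩
  · refine HasCompactSupport.intro (isCompact_Icc (a := (0 : ℝ)) (b := 2)) fun x hx => ?_
    have h (n : ℕ) : x ∉ I n := fun h => by
      have : ((2 : ℝ) ^ n)⁻¹ ≤ 1 := inv_le_one_of_one_le₀ (one_le_pow₀ (by norm_num))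
      exact hx ⟨le_trans (by positivity) h.1, by linarith [h.2]⟩
    simp [hF, hf0 (h _)]
  · have hs : HasSum (fun n => 𝓕 (F n) y) (𝓕 (fun x => ∑' n, F n x) y) := by
      simp only [Real.fourier_real_eq]
      have := hasSum_integral_of_summable_integral_norm (F := fun n x => 𝐞 (-(x * y)) • F n x)
        (μ := volume) (fun n => by
          simpa [mul_comm] using (Real.fourierIntegral_convergent_iff y).2 (hFi n))
        (by simpa only [Circle.norm_smul] using hsum)
      simpa only [Circle.smul_def, (hpt _).tsum_const_smul] using this
    rw [← hs.tsum_eq, mul_assoc]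
    refine tsum_of_norm_bounded (has.hasSum.mul_right _) fun n => ?_
    rw [fourier_const_mul, norm_mul, Complex.norm_real, norm_of_nonneg (ha0 n)]
    exact mul_le_mul_of_nonneg_left (hff n y) (ha0 n)
  · refine ENNReal.eq_top_of_forall_nnreal_le fun r => ?_
    have hlim := (tendsto_exp_mul_div_rpow_atTop (2 * (1 + ε)) (log 2 * ε)
      (mul_pos (log_pos one_lt_two) hε)).comp tendsto_natCast_atTop_atTop
    obtain ⟨n, hn, hn1⟩ :=
      ((hlim.eventually_ge_atTop (r : ℝ)).and (Filter.eventually_ge_atTop 1)).exists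
    calc (r : ENNReal) = ENNReal.ofReal r := by simp
      _ ≤ ENNReal.ofReal (rexp (log 2 * ε * n) / (n : ℝ) ^ (2 * (1 + ε))) :=
          ENNReal.ofReal_le_ofReal hn
      _ = ∫⁻ x in I n, ENNReal.ofReal (a n * 2 ^ n) ^ (1 + ε) :=
          (setLIntegral_dyadic_Ico n hn1 ε).symm
      _ = ∫⁻ x in I n, (‖∑' m, F m x‖₊ : ENNReal) ^ (1 + ε) := by
          refine setLIntegral_congr_fun measurableSet_Ico fun x hx => ?_
          rw [tsum_eq_single n (hFx hx), ← enorm_eq_nnnorm, ← ofReal_norm, norm_mul,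
            Complex.norm_real, norm_of_nonneg (ha0 n), hfn, Set.indicator_of_mem hx]
      _ ≤ _ := setLIntegral_le_lintegral _ _
end

section
/- Let K be a field of characteristic zero, let m ≥ 2 and let 1 ≤ d < m be integers. Let Φ_d : K[y₁, …, y_m] → K[x_{i,j} : 1 ≤ i ≤ d, 1 ≤ j ≤ m] be the K-algebra homomorphism determined by Φ_d(y₁) = Σ_{i=1}^d x_{i,1}² and Φ_d(y_j) = Σ_{i=1}^d x_{i,1}² x_{i,j}² for 2 ≤ j ≤ m. Then Φ_d is not flat, i.e., K[x_{i,j} : 1 ≤ i ≤ d, 1 ≤ j ≤ m] is not flat as a module over K[y₁, …, y_m] via Φ_d. -/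
open MvPolynomial

/-- The endomorphism of `R[X₀, …, X_{n-1}]` killing the first `k` variables. -/
noncomputable def MvPolynomial.killFirst (R : Type*) [CommRing R] (n k : ℕ) :
    MvPolynomial (Fin n) R →ₐ[R] MvPolynomial (Fin n) R :=
  aeval fun j => if (j : ℕ) < k then 0 else X j

lemma MvPolynomial.killFirst_X {R : Type*} [CommRing R] {n : ℕ} (k : ℕ) (j : Fin n) :
    killFirst R n k (X j) = if (j : ℕ) < k then 0 else X j :=
  aeval_X _ _

lemma MvPolynomial.killFirst_succ_comp_killFirst (R : Type*) [CommRing R] (n k : ℕ) :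
    (killFirst R n (k + 1)).comp (killFirst R n k) = killFirst R n (k + 1) := by
  refine algHom_ext fun j => ?_
  rw [AlgHom.comp_apply, killFirst_X]
  split_ifs with h
  · rw [map_zero, killFirst_X, if_pos (by omega)]
  · rfl

lemma MvPolynomial.ker_killFirst_lt_succ {R : Type*} [CommRing R] [Nontrivial R] {n k : ℕ}
    (hk : k < n) : RingHom.ker (killFirst R n k) < RingHom.ker (killFirst R n (k + 1)) := by
  refine SetLike.lt_iff_le_and_exists.2 ⟨fun f hf => ?_, X ⟨k, hk⟩, ?_, ?_⟩
  · rw [RingHom.mem_ker] at hf ⊢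
    rw [← killFirst_succ_comp_killFirst, AlgHom.comp_apply, hf, map_zero]
  · rw [RingHom.mem_ker, killFirst_X, if_pos (Nat.lt_succ_self k)]
  · rw [RingHom.mem_ker, killFirst_X, if_neg (lt_irrefl k)]
    exact X_ne_zero _

lemma MvPolynomial.le_height_ker_killFirst (R : Type*) [CommRing R] [IsDomain R] {n k : ℕ}
    (hk : k ≤ n) : (k : ℕ∞) ≤ (RingHom.ker (killFirst R n k)).height := by
  induction k with
  | zero => simp
  | succ k ih =>
    have := RingHom.ker_isPrime (killFirst R n k)
    have := RingHom.ker_isPrime (killFirst R n (k + 1))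
    calc ((k + 1 : ℕ) : ℕ∞) = k + 1 := by push_cast; rfl
      _ ≤ (RingHom.ker (killFirst R n k)).height + 1 := by gcongr; exact ih (by omega)
      _ ≤ _ := Ideal.height_add_one_le_of_lt_of_isPrime (ker_killFirst_lt_succ hk)

lemma MvPolynomial.le_height_of_forall_X_mem {R : Type*} [CommRing R] [IsDomain R] {n : ℕ}
    {I : Ideal (MvPolynomial (Fin n) R)} (hI : ∀ j, X j ∈ I) : (n : ℕ∞) ≤ I.height := by
  refine (le_height_ker_killFirst R le_rfl).trans (Ideal.height_mono fun f hf => ?_)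
  have h : (Ideal.Quotient.mkₐ R I).comp (killFirst R n n) = Ideal.Quotient.mkₐ R I := by
    refine algHom_ext fun j => ?_
    rw [AlgHom.comp_apply, killFirst_X, if_pos j.isLt, map_zero]
    exact (Ideal.Quotient.eq_zero_iff_mem.2 (hI j)).symm
  rw [← Ideal.Quotient.eq_zero_iff_mem, ← Ideal.Quotient.mkₐ_eq_mk R, ← h, AlgHom.comp_apply,
    RingHom.mem_ker.1 hf, map_zero]

/-- Contraction along a flat homomorphism of Noetherian rings does not increase the height
of a prime. -/
lemma RingHom.Flat.height_comap_le {R S : Type*} [CommRing R] [CommRing S] [IsNoetherianRing R]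
    [IsNoetherianRing S] {f : R →+* S} (hf : f.Flat) (Q : Ideal S) [Q.IsPrime] : (Q.comap f).height ≤ Q.height := by
  algebraize [f]
  have : Q.LiesOver (Q.comap f) := ⟨rfl⟩
  rw [Ideal.height_eq_height_add_of_liesOver_of_hasGoingDown (Q.comap f) Q]
  exact le_self_add

/-- Let `K` be a field of characteristic zero, `m ≥ 2` and
`1 ≤ d < m`.  The `K`-algebra homomorphism
`Φ_d : K[y₁, …, y_m] → K[x_{i,j} : 1 ≤ i ≤ d, 1 ≤ j ≤ m]` determined by
`y₁ ↦ Σ_i x_{i,1}²` and `y_j ↦ Σ_i x_{i,1}² x_{i,j}²` (for `j ≥ 2`) is not flat. -/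
theorem convolution_power_example_not_flat
    {K : Type*} [Field K] [CharZero K] (m d : ℕ)
    (hm : 2 ≤ m) (hd : 1 ≤ d) (hdm : d < m) :
    ¬ RingHom.Flat
      ((MvPolynomial.aeval (R := K) (fun j : Fin m =>
          if j = (⟨0, by omega⟩ : Fin m) then
            ∑ i : Fin d, (X (i, (⟨0, by omega⟩ : Fin m))) ^ 2
          else
            ∑ i : Fin d, (X (i, (⟨0, by omega⟩ : Fin m))) ^ 2 * (X (i, j)) ^ 2)
        : MvPolynomial (Fin m) K →ₐ[K] MvPolynomial (Fin d × Fin m) K).toRingHom) := by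
  classical
  intro hflat
  let s : Finset (MvPolynomial (Fin d × Fin m) K) :=
    Finset.univ.image fun i : Fin d => X (i, (⟨0, by omega⟩ : Fin m))
  have hs : Ideal.span (s : Set (MvPolynomial (Fin d × Fin m) K)) ≠ ⊤ := by
    refine ne_top_of_le_ne_top (RingHom.ker_ne_top (constantCoeff (R := K))) ?_
    rw [Ideal.span_le]
    intro p hp
    obtain ⟨i, -, rfl⟩ := Finset.mem_image.1 hp
    exact constantCoeff_X K _
  obtain ⟨Q, hQ⟩ := Ideal.nonempty_minimalPrimes hs
  have : Q.IsPrime := hQ.1.1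
  have hXQ (i : Fin d) : X (i, (⟨0, by omega⟩ : Fin m)) ∈ Q :=
    hQ.1.2 (Ideal.subset_span (Finset.mem_image_of_mem _ (Finset.mem_univ i)))
  have hQd : Q.height ≤ d :=
    (Ideal.height_le_card_of_mem_minimalPrimes_span_finset hQ).trans
      (by exact_mod_cast Finset.card_image_le.trans (Finset.card_fin d).le)
  have hle : (m : ℕ∞) ≤ d := by
    refine (le_height_of_forall_X_mem fun j => ?_).trans ((hflat.height_comap_le Q).trans hQd)
    rw [Ideal.mem_comap]
    simp only [AlgHom.toRingHom_eq_coe, RingHom.coe_coe, aeval_X]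
    split_ifs
    · exact sum_mem fun i _ => Ideal.pow_mem_of_mem _ (hXQ i) 2 two_pos
    · exact sum_mem fun i _ => Ideal.mul_mem_right _ _ (Ideal.pow_mem_of_mem _ (hXQ i) 2 two_pos)
  exact absurd (Nat.cast_le.1 hle) (not_le.2 hdm)
end

section
/- Let K be a field of characteristic zero and let m ≥ 1 be an integer. Consider the polynomial ring K[x_{i,j} : 1 ≤ i ≤ m, 1 ≤ j ≤ m] and the ideal I generated by the m elements Σ_{i=1}^m x_{i,1}² and Σ_{i=1}^m x_{i,1}² x_{i,j}² for 2 ≤ j ≤ m. Then the quotient ring K[x_{i,j} : 1 ≤ i, j ≤ m] / I is not reduced, i.e., it contains a nonzero nilpotent element. -/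
open MvPolynomial

section Fiber

variable {K : Type*} [Field K] {n : ℕ}

/-- The matrix `M` such that the row vector `(x_{i,0}²)_i` times `M` lists the generators of the
ideal of the fiber. -/
noncomputable def fiberMatrix (K : Type*) [Field K] {n : ℕ} (z : Fin n) :
    Matrix (Fin n) (Fin n) (MvPolynomial (Fin n × Fin n) K) :=
  Matrix.of fun i j => if j = z then 1 else X (i, j) ^ 2

/-- The generators of the ideal of the fiber. -/
noncomputable def fiberGen (K : Type*) [Field K] {n : ℕ} (z j : Fin n) :
    MvPolynomial (Fin n × Fin n) K :=
  if j = z then ∑ i : Fin n, X (i, z) ^ 2 else ∑ i : Fin n, X (i, z) ^ 2 * X (i, j) ^ 2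

theorem vecMul_fiberMatrix (z : Fin n) :
    Matrix.vecMul (fun i => X (i, z) ^ 2) (fiberMatrix K z) = fiberGen K z := by
  ext1 j
  by_cases h : j = z <;> simp [Matrix.vecMul, dotProduct, fiberMatrix, fiberGen, h]

theorem det_fiberMatrix_mul_sq_mem (z i : Fin n) :
    (fiberMatrix K z).det * X (i, z) ^ 2 ∈ Ideal.span (Set.range (fiberGen K z)) := by
  have h : Matrix.vecMul (fiberGen K z) (fiberMatrix K z).adjugate i =
      (fiberMatrix K z).det * X (i, z) ^ 2 := by
    rw [← vecMul_fiberMatrix, Matrix.vecMul_vecMul, Matrix.mul_adjugate, Matrix.vecMul_smul,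
      Matrix.vecMul_one]
    rfl
  rw [← h]
  simp only [Matrix.vecMul, dotProduct]
  refine Ideal.sum_mem (Ideal.span (Set.range (fiberGen K z))) fun j _ => ?_
  exact Ideal.mul_mem_right _ _ (Ideal.subset_span (Set.mem_range_self j))

/-- Evaluation at the dual-number point `x_{i,z} = ε`, `x_{i,j} = i ^ j` for `j ≠ z`. -/
noncomputable def dualEval (K : Type*) [Field K] {n : ℕ} (z : Fin n) :
    MvPolynomial (Fin n × Fin n) K →+* DualNumber K :=
  (aeval fun p : Fin n × Fin n =>
    if p.2 = z then DualNumber.eps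
    else TrivSqZeroExt.inl (((p.1 : ℕ) : K) ^ (p.2 : ℕ)) : _ →ₐ[K] DualNumber K)

theorem dualEval_X_self (z i : Fin n) : dualEval K z (X (i, z)) = DualNumber.eps := by
  simp [dualEval]

theorem dualEval_X_of_ne {z j : Fin n} (h : j ≠ z) (i : Fin n) :
    dualEval K z (X (i, j)) = TrivSqZeroExt.inl (((i : ℕ) : K) ^ (j : ℕ)) := by
  simp [dualEval, h]

theorem dualEval_fiberGen (z j : Fin n) : dualEval K z (fiberGen K z j) = 0 := by
  by_cases h : j = z <;> simp [fiberGen, h, dualEval_X_self, pow_two]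

theorem dualEval_det_fiberMatrix {z : Fin n} (hz : (z : ℕ) = 0) :
    dualEval K z (fiberMatrix K z).det =
      TrivSqZeroExt.inl (Matrix.vandermonde fun i : Fin n => ((i : ℕ) : K) ^ 2).det := by
  change _ = TrivSqZeroExt.inlHom K K _
  rw [RingHom.map_det, RingHom.map_det]
  congr 1
  ext1 i j
  by_cases h : j = z
  · simp [fiberMatrix, h, hz]
  · simp [fiberMatrix, h, dualEval_X_of_ne h, ← pow_mul, mul_comm,
      ← TrivSqZeroExt.inl_pow]

theorem det_fiberMatrix_mul_X_notMem [CharZero K] {z : Fin n} (hz : (z : ℕ) = 0) (i : Fin n) :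
    (fiberMatrix K z).det * X (i, z) ∉ Ideal.span (Set.range (fiberGen K z)) := by
  intro hmem
  have hle : Ideal.span (Set.range (fiberGen K z)) ≤ RingHom.ker (dualEval K z) := by
    rw [Ideal.span_le]
    rintro _ ⟨j, rfl⟩
    exact dualEval_fiberGen z j
  have h : dualEval K z ((fiberMatrix K z).det * X (i, z)) = 0 := hle hmem
  rw [map_mul, dualEval_det_fiberMatrix hz, dualEval_X_self] at h
  have h' := congrArg TrivSqZeroExt.snd h
  have hdet : (Matrix.vandermonde fun i : Fin n => ((i : ℕ) : K) ^ 2).det ≠ 0 := by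
    rw [Matrix.det_vandermonde_ne_zero_iff]
    intro a b hab
    beta_reduce at hab
    have hab' : (a : ℕ) ^ 2 = (b : ℕ) ^ 2 := by exact_mod_cast hab
    exact Fin.ext (Nat.pow_left_injective two_ne_zero hab')
  exact hdet (by simpa using h')

end Fiber

/-- Let `K` be a field of characteristic zero and `m ≥ 1`.  The
quotient of `K[x_{i,j} : 1 ≤ i, j ≤ m]` by the ideal generated by the `m` elements
`Σ_i x_{i,1}²` and `Σ_i x_{i,1}² x_{i,j}²` (for `2 ≤ j ≤ m`) is not reduced. -/
theorem convolution_power_example_fiber_not_reduced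
    {K : Type*} [Field K] [CharZero K] (m : ℕ) (hm : 1 ≤ m) :
    ¬ IsReduced (MvPolynomial (Fin m × Fin m) K ⧸
      Ideal.span (Set.range (fun j : Fin m =>
        if j = (⟨0, by omega⟩ : Fin m) then
          ∑ i : Fin m, (X (i, (⟨0, by omega⟩ : Fin m))
            : MvPolynomial (Fin m × Fin m) K) ^ 2
        else
          ∑ i : Fin m, (X (i, (⟨0, by omega⟩ : Fin m))) ^ 2 * (X (i, j)) ^ 2))) := by
  intro hred
  let z : Fin m := ⟨0, by omega⟩
  change IsReduced (_ ⧸ Ideal.span (Set.range (fiberGen K z))) at hred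
  rw [← Ideal.isRadical_iff_quotient_reduced] at hred
  refine det_fiberMatrix_mul_X_notMem (K := K) (z := z) rfl z (hred ⟨2, ?_⟩)
  rw [mul_pow, pow_two (fiberMatrix K z).det, mul_assoc]
  exact Ideal.mul_mem_left _ _ (det_fiberMatrix_mul_sq_mem z z)
end
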